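/- arXiv:2512.08167 — 3 statements merged into one kernel-verified Lean document; each statement's English description precedes it below -/
import Mathlib

section
/- Let h : ℝ^n → ℝ be convex and L-smooth and bounded below, let K be a real p × n matrix, c ∈ ℝ^p, and let S = {x : Kx = c} be nonempty. Fix x⁰ ∈ ℝ^n, R > 0, ε > 0, set μ = ε/R² and h_μ(x) = h(x) + (μ/2)‖x − x⁰‖². Suppose x* minimizes h over S with ‖x⁰ − x*‖² ≤ R², let x_μ* be the (unique) minimizer of h_μ over S, let M = h(x*) − inf_{x ∈ ℝ^n} h(x), and let x̂ ∈ ℝ^n satisfy ‖x̂ − x_μ*‖² ≤ δ, where δ > 0 is small enough that √(2(L+μ)(M + ε/2)δ) ≤ ε/64 and (L+μ)δ/2 ≤ ε/4. Then h(x̂) − h(x*) ≤ ε. -/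
open RealInnerProductSpace in
/-- The descent inequality with constant `L > 0` bounds the squared gradient norm at `x` by
`2 * L` times the gap between the value at `x` and any lower bound of the function. -/
theorem norm_sq_gradient_le_of_descent {E : Type*} [NormedAddCommGroup E]
    [InnerProductSpace ℝ E] {f : E → ℝ} {g x : E} {L m : ℝ} (hL : 0 < L)
    (hdescent : ∀ y, f y ≤ f x + ⟪g, y - x⟫ + L / 2 * ‖y - x‖ ^ 2)
    (hm : ∀ y, m ≤ f y) : ‖g‖ ^ 2 ≤ 2 * L * (f x - m) := by
  have key := (hm _).trans (hdescent (x - L⁻¹ • g))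
  have hsub : x - L⁻¹ • g - x = -(L⁻¹ • g) := by abel
  rw [hsub, inner_neg_right, inner_smul_right, real_inner_self_eq_norm_sq, norm_neg, norm_smul,
    Real.norm_of_nonneg (inv_nonneg.2 hL.le), mul_pow] at key
  have hstep : L / 2 * (L⁻¹ ^ 2 * ‖g‖ ^ 2) = L⁻¹ * ‖g‖ ^ 2 / 2 := by
    field_simp
  have hgap : L⁻¹ * ‖g‖ ^ 2 ≤ 2 * (f x - m) := by linarith
  calc ‖g‖ ^ 2 = L * (L⁻¹ * ‖g‖ ^ 2) := by field_simp
    _ ≤ L * (2 * (f x - m)) := by gcongr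
    _ = 2 * L * (f x - m) := by ring


open RealInnerProductSpace in
/-- Regularization lemma: if the regularized problem (with `μ = ε/R²`) is solved up
to accuracy `δ` small enough, the resulting point solves the original affinely
constrained problem up to accuracy `ε`. -/
theorem regularization_affine_constraints {n p : ℕ}
    (h : EuclideanSpace ℝ (Fin n) → ℝ)
    (h' : EuclideanSpace ℝ (Fin n) → EuclideanSpace ℝ (Fin n))
    (hconv : ConvexOn ℝ Set.univ h)
    (hdiff : ∀ x, HasGradientAt h (h' x) x)
    (L : ℝ) (hL : 0 ≤ L)
    (hsmooth : ∀ x y, h y ≤ h x + ⟪h' x, y - x⟫ + L / 2 * ‖y - x‖ ^ 2)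
    (hbdd : BddBelow (Set.range h))
    (K : Matrix (Fin p) (Fin n) ℝ) (c : EuclideanSpace ℝ (Fin p))
    (S : Set (EuclideanSpace ℝ (Fin n)))
    (hS : S = {x | K.toEuclideanLin x = c}) (hSne : S.Nonempty)
    (x0 : EuclideanSpace ℝ (Fin n)) (R ε : ℝ) (hR : 0 < R) (hε : 0 < ε)
    (μ : ℝ) (hμ : μ = ε / R ^ 2)
    (hmu : EuclideanSpace ℝ (Fin n) → ℝ)
    (hmu_def : ∀ x, hmu x = h x + μ / 2 * ‖x - x0‖ ^ 2)
    (xs : EuclideanSpace ℝ (Fin n)) (hxs_mem : xs ∈ S) (hxs_min : IsMinOn h S xs)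
    (hxs_R : ‖x0 - xs‖ ^ 2 ≤ R ^ 2)
    (xmu : EuclideanSpace ℝ (Fin n)) (hxmu_mem : xmu ∈ S)
    (hxmu_min : IsMinOn hmu S xmu)
    (M : ℝ) (hM : M = h xs - ⨅ x, h x)
    (δ : ℝ) (hδ : 0 < δ)
    (hδ1 : Real.sqrt (2 * (L + μ) * (M + ε / 2) * δ) ≤ ε / 64)
    (hδ2 : (L + μ) * δ / 2 ≤ ε / 4)
    (xhat : EuclideanSpace ℝ (Fin n)) (hxhat : ‖xhat - xmu‖ ^ 2 ≤ δ) :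
    h xhat - h xs ≤ ε := by
  have hμ_pos : 0 < μ := by rw [hμ]; positivity
  have hLμ : 0 < L + μ := by linarith
  have hxmu_le : h xmu ≤ h xs + ε / 2 := by
    have hmin : hmu xmu ≤ hmu xs := hxmu_min hxs_mem
    rw [hmu_def, hmu_def, norm_sub_rev xs x0] at hmin
    have hpen : μ / 2 * ‖x0 - xs‖ ^ 2 ≤ μ / 2 * R ^ 2 := by gcongr
    have hμR : μ / 2 * R ^ 2 = ε / 2 := by rw [hμ]; field_simp
    have hnonneg : 0 ≤ μ / 2 * ‖xmu - x0‖ ^ 2 := by positivity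
    linarith
  have hgrad : ‖h' xmu‖ ^ 2 ≤ 2 * (L + μ) * (M + ε / 2) := by
    refine (norm_sq_gradient_le_of_descent (x := xmu) hLμ (fun y ↦ (hsmooth xmu y).trans ?_)
      (ciInf_le hbdd)).trans ?_
    · gcongr
      linarith
    · gcongr
      linarith
  have hinner : ⟪h' xmu, xhat - xmu⟫ ≤ ε / 64 := by
    refine (real_inner_le_norm _ _).trans ((Real.le_sqrt_of_sq_le ?_).trans hδ1)
    rw [mul_pow]
    exact mul_le_mul hgrad hxhat (by positivity) ((sq_nonneg _).trans hgrad)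
  have hquad : L / 2 * ‖xhat - xmu‖ ^ 2 ≤ ε / 4 := by
    calc L / 2 * ‖xhat - xmu‖ ^ 2 ≤ (L + μ) / 2 * δ := by
          gcongr
          linarith
      _ = (L + μ) * δ / 2 := by ring
      _ ≤ ε / 4 := hδ2
  linarith [hsmooth xmu xhat]
end

section
/- Let h : ℝ^n → ℝ be convex, L-smooth and bounded below, let S = {x : Kx = c} be a nonempty affine set, μ > 0, x⁰ ∈ ℝ^n, and h_μ(x) = h(x) + (μ/2)‖x − x⁰‖². Let x* minimize h over S, let x_μ* be the unique minimizer of h_μ over S, set M = h(x*) − inf_{x∈ℝ^n} h(x), and suppose ‖x⁰ − x*‖² ≤ R² and ‖x̂ − x_μ*‖² ≤ δ for some x̂ ∈ ℝ^n. Then h(x̂) − h(x*) ≤ √(2(L+μ)(M + μR²/2)δ) + ((L+μ)/2)δ + (μ/2)R². -/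
open RealInnerProductSpace in
/-- A function with a quadratic upper bound at `x` that is bounded below by `m` has a small
slope at `x`. -/
theorem norm_sq_le_of_quadratic_upper_bound {E : Type*} [NormedAddCommGroup E]
    [InnerProductSpace ℝ E] {f : E → ℝ} {x g : E} {C m : ℝ} (hC : 0 < C)
    (hf : ∀ y, f y ≤ f x + ⟪g, y - x⟫ + C / 2 * ‖y - x‖ ^ 2) (hm : ∀ y, m ≤ f y) :
    ‖g‖ ^ 2 ≤ 2 * C * (f x - m) := by
  have key := (hm _).trans (hf (x - C⁻¹ • g))
  rw [sub_sub_cancel_left, inner_neg_right, norm_neg, real_inner_smul_right,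
    real_inner_self_eq_norm_sq, norm_smul, mul_pow, Real.norm_eq_abs, sq_abs] at key
  have hstep : -(C⁻¹ * ‖g‖ ^ 2) + C / 2 * (C⁻¹ ^ 2 * ‖g‖ ^ 2) = -(‖g‖ ^ 2 / (2 * C)) := by
    field_simp
    ring
  have hle : ‖g‖ ^ 2 / (2 * C) ≤ f x - m := by linarith
  rwa [div_le_iff₀' (by positivity)] at hle

open RealInnerProductSpace in
/-- Tikhonov regularization preserves a quadratic upper bound. -/
theorem quadratic_upper_bound_add_tikhonov {E : Type*} [NormedAddCommGroup E]
    [InnerProductSpace ℝ E] {f : E → ℝ} {x y g : E} {C : ℝ}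
    (hf : f y ≤ f x + ⟪g, y - x⟫ + C / 2 * ‖y - x‖ ^ 2) (μ : ℝ) (z : E) :
    f y + μ / 2 * ‖y - z‖ ^ 2 ≤ f x + μ / 2 * ‖x - z‖ ^ 2
      + ⟪g + μ • (x - z), y - x⟫ + (C + μ) / 2 * ‖y - x‖ ^ 2 := by
  have hsq : ‖y - z‖ ^ 2 = ‖x - z‖ ^ 2 + 2 * ⟪x - z, y - x⟫ + ‖y - x‖ ^ 2 := by
    rw [← norm_add_sq_real, add_comm, sub_add_sub_cancel]
  rw [hsq, inner_add_left, real_inner_smul_left]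
  linarith

open RealInnerProductSpace in
/-- Quantitative regularization bound: solving the Tikhonov-regularized problem
over the affine set `S = {x | K x = c}` up to accuracy `δ` gives a point whose
suboptimality for the original problem is bounded explicitly. -/
theorem regularization_affine_constraints_bound {n p : ℕ}
    (h : EuclideanSpace ℝ (Fin n) → ℝ)
    (h' : EuclideanSpace ℝ (Fin n) → EuclideanSpace ℝ (Fin n))
    (hconv : ConvexOn ℝ Set.univ h)
    (hdiff : ∀ x, HasGradientAt h (h' x) x)
    (L : ℝ) (hL : 0 ≤ L)
    (hsmooth : ∀ x y, h y ≤ h x + ⟪h' x, y - x⟫ + L / 2 * ‖y - x‖ ^ 2)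
    (hbdd : BddBelow (Set.range h))
    (K : Matrix (Fin p) (Fin n) ℝ) (c : EuclideanSpace ℝ (Fin p))
    (S : Set (EuclideanSpace ℝ (Fin n)))
    (hS : S = {x | K.toEuclideanLin x = c}) (hSne : S.Nonempty)
    (μ : ℝ) (hμ : 0 < μ)
    (x0 : EuclideanSpace ℝ (Fin n))
    (hmu : EuclideanSpace ℝ (Fin n) → ℝ)
    (hmu_def : ∀ x, hmu x = h x + μ / 2 * ‖x - x0‖ ^ 2)
    (xs : EuclideanSpace ℝ (Fin n)) (hxs_mem : xs ∈ S) (hxs_min : IsMinOn h S xs)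
    (xmu : EuclideanSpace ℝ (Fin n)) (hxmu_mem : xmu ∈ S)
    (hxmu_min : IsMinOn hmu S xmu)
    (M : ℝ) (hM : M = h xs - ⨅ x, h x)
    (R δ : ℝ) (hxs_R : ‖x0 - xs‖ ^ 2 ≤ R ^ 2)
    (xhat : EuclideanSpace ℝ (Fin n)) (hxhat : ‖xhat - xmu‖ ^ 2 ≤ δ) :
    h xhat - h xs ≤
      Real.sqrt (2 * (L + μ) * (M + μ * R ^ 2 / 2) * δ)
        + (L + μ) / 2 * δ + μ / 2 * R ^ 2 := by
  have hC : 0 < L + μ := by positivity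
  set g := h' xmu + μ • (xmu - x0)
  have hquad (y) : hmu y ≤ hmu xmu + ⟪g, y - xmu⟫ + (L + μ) / 2 * ‖y - xmu‖ ^ 2 := by
    simpa only [hmu_def] using quadratic_upper_bound_add_tikhonov (hsmooth xmu y) μ x0
  have hle (y) : h y ≤ hmu y := by
    rw [hmu_def]
    exact le_add_of_nonneg_right (by positivity)
  have hg := norm_sq_le_of_quadratic_upper_bound hC hquad fun y => (ciInf_le hbdd y).trans (hle y)
  have hopt : hmu xmu ≤ h xs + μ / 2 * R ^ 2 := by
    refine (hxmu_min hxs_mem).trans ?_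
    rw [hmu_def, norm_sub_rev]
    gcongr
  have hg' : ‖g‖ ^ 2 ≤ 2 * (L + μ) * (M + μ * R ^ 2 / 2) := by
    refine hg.trans ?_
    gcongr
    linarith
  have hinner : ⟪g, xhat - xmu⟫ ≤ √(2 * (L + μ) * (M + μ * R ^ 2 / 2) * δ) := by
    refine (real_inner_le_norm _ _).trans (Real.le_sqrt_of_sq_le ?_)
    rw [mul_pow]
    exact mul_le_mul hg' hxhat (by positivity) ((sq_nonneg _).trans hg')
  have hdist : (L + μ) / 2 * ‖xhat - xmu‖ ^ 2 ≤ (L + μ) / 2 * δ := by gcongr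
  linarith [hle xhat, hquad xhat]
end

section
/- Let Q ⊆ ℝ^n be a nonempty closed convex set and f : ℝ^n → ℝ a μ-strongly convex continuous function with μ > 0. For y ∈ ℝ^n let x(y) denote the unique maximizer over Q of x ↦ ⟨x, y⟩ − f(x). Then the map y ↦ x(y) is (1/μ)-Lipschitz: ‖x(y₁) − x(y₂)‖ ≤ (1/μ)‖y₁ − y₂‖ for all y₁, y₂ ∈ ℝ^n. -/
open Filter Topology in
/-- A strongly convex function grows at least quadratically away from a minimizer. -/
theorem StrongConvexOn.add_norm_sq_le_of_isMinOn {E : Type*} [NormedAddCommGroup E]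
    [NormedSpace ℝ E] {s : Set E} {m : ℝ} {g : E → ℝ} {x w : E}
    (hg : StrongConvexOn s m g) (hmin : IsMinOn g s x) (hx : x ∈ s) (hw : w ∈ s) :
    g x + m / 2 * ‖w - x‖ ^ 2 ≤ g w := by
  have hbound : ∀ᶠ t : ℝ in 𝓝[>] 0, g x + (1 - t) * (m / 2 * ‖w - x‖ ^ 2) ≤ g w := by
    filter_upwards [Ioo_mem_nhdsGT (zero_lt_one' ℝ)] with t ht
    have hsum : t + (1 - t) = 1 := add_sub_cancel _ _
    have hle := hg.2 hw hx ht.1.le (sub_nonneg.2 ht.2.le) hsum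
    have hge := isMinOn_iff.1 hmin _ (hg.1 hw hx ht.1.le (sub_nonneg.2 ht.2.le) hsum)
    simp only [smul_eq_mul] at hle
    refine le_of_mul_le_mul_left ?_ ht.1
    linarith
  have hlim : Tendsto (fun t : ℝ => g x + (1 - t) * (m / 2 * ‖w - x‖ ^ 2)) (𝓝[>] 0)
      (𝓝 (g x + m / 2 * ‖w - x‖ ^ 2)) := by
    refine tendsto_nhdsWithin_of_tendsto_nhds (Continuous.tendsto' (by fun_prop) _ _ ?_)
    simp
  exact le_of_tendsto hlim hbound

open RealInnerProductSpace in
/-- Subtracting a linear functional preserves strong convexity. -/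
theorem StrongConvexOn.sub_inner {E : Type*} [NormedAddCommGroup E] [InnerProductSpace ℝ E]
    {s : Set E} {m : ℝ} {f : E → ℝ} (hf : StrongConvexOn s m f) (y : E) :
    StrongConvexOn s m (fun x => f x - ⟪x, y⟫) := by
  refine ⟨hf.1, fun x hx z hz a b ha hb hab => ?_⟩
  have h := hf.2 hx hz ha hb hab
  simp only [smul_eq_mul, inner_add_left, real_inner_smul_left] at h ⊢
  linarith

open RealInnerProductSpace in
/-- The constrained maximizer map `y ↦ x(y) = argmax_{x ∈ Q} (⟨x, y⟩ − f(x))` of a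
`μ`-strongly convex continuous function over a nonempty closed convex set `Q`
is `(1/μ)`-Lipschitz. -/
theorem argmax_map_lipschitz {n : ℕ}
    (Q : Set (EuclideanSpace ℝ (Fin n))) (hQne : Q.Nonempty)
    (hQclosed : IsClosed Q) (hQconvex : Convex ℝ Q)
    (f : EuclideanSpace ℝ (Fin n) → ℝ)
    (μ : ℝ) (hμ : 0 < μ)
    (hsc : ConvexOn ℝ Set.univ (fun x => f x - μ / 2 * ‖x‖ ^ 2))
    (hcont : Continuous f)
    (xm : EuclideanSpace ℝ (Fin n) → EuclideanSpace ℝ (Fin n))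
    (hxm_mem : ∀ y, xm y ∈ Q)
    (hxm_max : ∀ y, ∀ w ∈ Q, ⟪w, y⟫ - f w ≤ ⟪xm y, y⟫ - f (xm y)) :
    ∀ y₁ y₂ : EuclideanSpace ℝ (Fin n),
      ‖xm y₁ - xm y₂‖ ≤ 1 / μ * ‖y₁ - y₂‖ := by
  intro y₁ y₂
  have hgrowth (y w : EuclideanSpace ℝ (Fin n)) (hw : w ∈ Q) :
      f (xm y) - ⟪xm y, y⟫ + μ / 2 * ‖w - xm y‖ ^ 2 ≤ f w - ⟪w, y⟫ := by
    have hQ : StrongConvexOn Q μ f :=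
      strongConvexOn_iff_convex.2 (hsc.subset (Set.subset_univ Q) hQconvex)
    refine (hQ.sub_inner y).add_norm_sq_le_of_isMinOn (isMinOn_iff.2 fun z hz => ?_)
      (hxm_mem y) hw
    linarith [hxm_max y z hz]
  have h₁ := hgrowth y₁ (xm y₂) (hxm_mem y₂)
  have h₂ := hgrowth y₂ (xm y₁) (hxm_mem y₁)
  rw [norm_sub_rev] at h₁
  have hinner : μ * ‖xm y₁ - xm y₂‖ ^ 2 ≤ ⟪xm y₁ - xm y₂, y₁ - y₂⟫ := by
    simp only [inner_sub_left, inner_sub_right]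
    linarith
  have hcs := real_inner_le_norm (xm y₁ - xm y₂) (y₁ - y₂)
  rw [one_div, ← div_eq_inv_mul, le_div_iff₀' hμ]
  rcases (norm_nonneg (xm y₁ - xm y₂)).eq_or_lt with h | h
  · rw [← h, mul_zero]
    exact norm_nonneg _
  · refine le_of_mul_le_mul_left ?_ h
    linarith
end
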